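/- (Zero-free region criterion.) Let α > 1 and β > 0 be real numbers and let ρ be a real number with 1/2 ≤ ρ < α. If there exists a constant A > 0 such that |c_k(α,β)| ≤ A · k^{-(α-ρ)/β} for all integers k ≥ 1, then the Riemann zeta function ζ(s) has no zeros with Re(s) > ρ. -/

import Mathlib

open ArithmeticFunction

/-- The coefficient `c_k(α,β) = ∑_{n=1}^∞ μ(n) n^{-α} (1 - n^{-β})^k`. -/
noncomputable def cCoeff (α β : ℝ) (k : ℕ) : ℝ :=
  ∑' n : ℕ, (moebius n : ℝ) * (n : ℝ) ^ (-α) * (1 - (n : ℝ) ^ (-β)) ^ k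

open Filter Topology Asymptotics

/-- The function `t ↦ ∑ μ(n) n^{-α} exp(-n^{-β} t)`, whose Mellin transform is `Γ / ζ` up to an
affine change of variable. -/
noncomputable def moebiusExpSum (α β t : ℝ) : ℝ :=
  ∑' n : ℕ, (moebius n : ℝ) * (n : ℝ) ^ (-α) * Real.exp (-(n : ℝ) ^ (-β) * t)

lemma abs_moebius_mul_rpow_le (α : ℝ) (n : ℕ) :
    |(moebius n : ℝ) * (n : ℝ) ^ (-α)| ≤ (n : ℝ) ^ (-α) := by
  rw [abs_mul, abs_of_nonneg (Real.rpow_nonneg n.cast_nonneg _)]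
  exact mul_le_of_le_one_left (Real.rpow_nonneg n.cast_nonneg _)
    (by exact_mod_cast abs_moebius_le_one)

lemma summable_abs_moebius_mul_rpow {α : ℝ} (hα : 1 < α) :
    Summable fun n : ℕ ↦ |(moebius n : ℝ) * (n : ℝ) ^ (-α)| :=
  .of_nonneg_of_le (fun _ ↦ abs_nonneg _) (abs_moebius_mul_rpow_le α)
    (Real.summable_nat_rpow.2 (by linarith))

lemma natCast_rpow_neg_le_one {β : ℝ} (hβ : 0 < β) (n : ℕ) : (n : ℝ) ^ (-β) ≤ 1 := by
  rcases n.eq_zero_or_pos with rfl | hn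
  · simp [Real.zero_rpow (neg_ne_zero.2 hβ.ne')]
  · exact Real.rpow_le_one_of_one_le_of_nonpos (by exact_mod_cast hn) (by linarith)

lemma abs_moebiusExpSum_term_le (α β : ℝ) {t : ℝ} (ht : 0 ≤ t) (n : ℕ) :
    ‖(moebius n : ℝ) * (n : ℝ) ^ (-α) * Real.exp (-(n : ℝ) ^ (-β) * t)‖ ≤
      |(moebius n : ℝ) * (n : ℝ) ^ (-α)| := by
  rw [Real.norm_eq_abs, abs_mul, Real.abs_exp]
  refine mul_le_of_le_one_right (abs_nonneg _) (Real.exp_le_one_iff.2 ?_)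
  nlinarith [mul_nonneg (Real.rpow_nonneg n.cast_nonneg (-β)) ht]

lemma continuousOn_moebiusExpSum {α : ℝ} (β : ℝ) (hα : 1 < α) :
    ContinuousOn (moebiusExpSum α β) (Set.Ici 0) :=
  continuousOn_tsum (fun n ↦ by fun_prop) (summable_abs_moebius_mul_rpow hα)
    fun n _ ht ↦ abs_moebiusExpSum_term_le α β ht n

lemma hasSum_moebiusExpSum {α : ℝ} (β : ℝ) (hα : 1 < α) {t : ℝ} (ht : 0 ≤ t) :
    HasSum (fun n : ℕ ↦ (moebius n : ℝ) * (n : ℝ) ^ (-α) * Real.exp (-(n : ℝ) ^ (-β) * t))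
      (moebiusExpSum α β t) :=
  ((summable_abs_moebius_mul_rpow hα).of_norm_bounded
    (abs_moebiusExpSum_term_le α β ht)).hasSum

/-- Expanding `exp(t (1 - n^{-β}))` expresses `moebiusExpSum` as a Poisson average of the
coefficients. -/
lemma moebiusExpSum_eq_exp_mul_tsum {α β t : ℝ} (hα : 1 < α) (hβ : 0 < β) (ht : 0 ≤ t) :
    moebiusExpSum α β t =
      Real.exp (-t) * ∑' k : ℕ, t ^ k / (k.factorial : ℝ) * cCoeff α β k := by
  set f : ℕ → ℕ → ℝ := fun k n ↦ t ^ k / (k.factorial : ℝ) *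
    ((moebius n : ℝ) * (n : ℝ) ^ (-α) * (1 - (n : ℝ) ^ (-β)) ^ k) with hf
  have hsum : Summable (Function.uncurry f) := by
    refine Summable.of_norm_bounded (g := fun p : ℕ × ℕ ↦ t ^ p.1 / (p.1.factorial : ℝ) *
      |(moebius p.2 : ℝ) * (p.2 : ℝ) ^ (-α)|)
      (Summable.mul_of_nonneg (Real.summable_pow_div_factorial t)
        (summable_abs_moebius_mul_rpow hα) (fun k ↦ by positivity) fun _ ↦ abs_nonneg _) ?_
    rintro ⟨k, n⟩
    have h0 : 0 ≤ 1 - (n : ℝ) ^ (-β) := sub_nonneg.2 (natCast_rpow_neg_le_one hβ n)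
    have h1 : 1 - (n : ℝ) ^ (-β) ≤ 1 := by linarith [Real.rpow_nonneg n.cast_nonneg (-β)]
    simp only [Function.uncurry_apply_pair, hf, Real.norm_eq_abs]
    rw [abs_mul, abs_mul _ (_ ^ k), abs_of_nonneg (by positivity : 0 ≤ t ^ k / (k.factorial : ℝ)),
      abs_of_nonneg (pow_nonneg h0 k)]
    exact mul_le_mul_of_nonneg_left
      (mul_le_of_le_one_right (abs_nonneg _) (pow_le_one₀ h0 h1)) (by positivity)
  have hk (k : ℕ) : t ^ k / (k.factorial : ℝ) * cCoeff α β k = ∑' n, f k n := by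
    rw [cCoeff, tsum_mul_left]
  have hn (n : ℕ) : ∑' k, f k n = (moebius n : ℝ) * (n : ℝ) ^ (-α) *
      Real.exp (t * (1 - (n : ℝ) ^ (-β))) := by
    rw [Real.exp_eq_exp_ℝ, NormedSpace.exp_eq_tsum_div, ← tsum_mul_left]
    refine tsum_congr fun k ↦ ?_
    simp only [hf, mul_pow]
    ring
  simp_rw [hk]
  rw [← hsum.tsum_comm, ← tsum_mul_left, moebiusExpSum]
  refine tsum_congr fun n ↦ ?_
  rw [hn, mul_left_comm, ← Real.exp_add]
  ring_nf

lemma factorial_add_le (k m : ℕ) :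
    (k + m).factorial ≤ k.factorial * ((m + 1) * (k + 1)) ^ m := by
  rw [← Nat.factorial_mul_ascFactorial]
  gcongr
  refine (Nat.ascFactorial_le_pow_add k m).trans (Nat.pow_le_pow_left ?_ m)
  nlinarith

lemma pow_div_factorial_mul_div_rpow_le {θ t : ℝ} {m : ℕ} (hθ : 0 ≤ θ) (hm : θ ≤ m) (ht : 0 ≤ t)
    (k : ℕ) : t ^ k / (k.factorial : ℝ) * (t / (k + 1)) ^ θ ≤
      t ^ k / (k.factorial : ℝ) +
        ((m : ℝ) + 1) ^ m * (t ^ (k + m) / ((k + m).factorial : ℝ)) := by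
  have hx : 0 ≤ t / (k + 1) := by positivity
  have h1 : (t / (k + 1)) ^ θ ≤ 1 + (t / (k + 1)) ^ m := by
    rcases le_total (t / (k + 1)) 1 with h | h
    · linarith [Real.rpow_le_one hx h hθ, pow_nonneg hx m]
    · have := Real.rpow_le_rpow_of_exponent_le h hm
      rw [Real.rpow_natCast] at this
      linarith
  have h2 : ((k + m).factorial : ℝ) ≤ k.factorial * (((m : ℝ) + 1) * (k + 1)) ^ m := by
    exact_mod_cast factorial_add_le k m
  have h3 : t ^ k / (k.factorial : ℝ) * (t / (k + 1)) ^ m ≤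
      ((m : ℝ) + 1) ^ m * (t ^ (k + m) / ((k + m).factorial : ℝ)) := by
    rw [div_pow, div_mul_div_comm, ← pow_add, ← mul_div_assoc,
      div_le_div_iff₀ (by positivity) (by positivity)]
    calc t ^ (k + m) * ((k + m).factorial : ℝ)
        ≤ t ^ (k + m) * (k.factorial * (((m : ℝ) + 1) * (k + 1)) ^ m) := by gcongr
      _ = _ := by rw [mul_pow]; ring
  calc _ ≤ t ^ k / (k.factorial : ℝ) * (1 + (t / (k + 1)) ^ m) := by gcongr
    _ ≤ _ := by linarith

/-- Poisson averages preserve polynomial decay. -/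
lemma abs_exp_mul_tsum_le {c : ℕ → ℝ} {B θ t : ℝ} {m : ℕ} (hθ : 0 ≤ θ) (hm : θ ≤ m)
    (hc : ∀ k : ℕ, |c k| ≤ B * ((k : ℝ) + 1) ^ (-θ)) (ht : 0 < t) :
    |Real.exp (-t) * ∑' k : ℕ, t ^ k / (k.factorial : ℝ) * c k| ≤
      B * (1 + ((m : ℝ) + 1) ^ m) * t ^ (-θ) := by
  have hB : 0 ≤ B := by simpa using (abs_nonneg _).trans (hc 0)
  have hexp : HasSum (fun k : ℕ ↦ t ^ k / (k.factorial : ℝ)) (Real.exp t) := by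
    rw [Real.exp_eq_exp_ℝ]
    exact NormedSpace.expSeries_div_hasSum_exp t
  have hshift : Summable fun k : ℕ ↦ t ^ (k + m) / ((k + m).factorial : ℝ) :=
    (summable_nat_add_iff (f := fun k : ℕ ↦ t ^ k / (k.factorial : ℝ)) m).2 hexp.summable
  have hshift_le : ∑' k : ℕ, t ^ (k + m) / ((k + m).factorial : ℝ) ≤ Real.exp t := by
    rw [← hexp.tsum_eq, ← hexp.summable.sum_add_tsum_nat_add m]
    exact le_add_of_nonneg_left (Finset.sum_nonneg fun k _ ↦ by positivity)
  have hg : HasSum (fun k : ℕ ↦ B * t ^ (-θ) * (t ^ k / (k.factorial : ℝ) +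
      ((m : ℝ) + 1) ^ m * (t ^ (k + m) / ((k + m).factorial : ℝ)))) _ :=
    (hexp.add (hshift.hasSum.mul_left _)).mul_left _
  have hle (k : ℕ) : ‖t ^ k / (k.factorial : ℝ) * c k‖ ≤ B * t ^ (-θ) *
      (t ^ k / (k.factorial : ℝ) +
        ((m : ℝ) + 1) ^ m * (t ^ (k + m) / ((k + m).factorial : ℝ))) := by
    have hk : (0 : ℝ) ≤ k + 1 := by positivity
    have hid : ((k : ℝ) + 1) ^ (-θ) = t ^ (-θ) * (t / (k + 1)) ^ θ := by
      rw [Real.div_rpow ht.le hk, Real.rpow_neg hk, Real.rpow_neg ht.le]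
      have := (Real.rpow_pos_of_pos ht θ).ne'
      field_simp
    rw [Real.norm_eq_abs, abs_mul, abs_of_nonneg (by positivity : 0 ≤ t ^ k / (k.factorial : ℝ))]
    calc t ^ k / (k.factorial : ℝ) * |c k|
        ≤ t ^ k / (k.factorial : ℝ) * (B * ((k : ℝ) + 1) ^ (-θ)) := by gcongr; exact hc k
      _ = B * t ^ (-θ) * (t ^ k / (k.factorial : ℝ) * (t / (k + 1)) ^ θ) := by rw [hid]; ring
      _ ≤ _ := by
        gcongr
        exact pow_div_factorial_mul_div_rpow_le hθ hm ht.le k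
  rw [abs_mul, Real.abs_exp]
  calc Real.exp (-t) * |∑' k : ℕ, t ^ k / (k.factorial : ℝ) * c k|
      ≤ Real.exp (-t) * (B * t ^ (-θ) * (Real.exp t + ((m : ℝ) + 1) ^ m * Real.exp t)) := by
        gcongr
        exact (tsum_of_norm_bounded hg hle).trans (by gcongr)
    _ = B * (1 + ((m : ℝ) + 1) ^ m) * t ^ (-θ) * (Real.exp (-t) * Real.exp t) := by ring
    _ = _ := by rw [← Real.exp_add]; simp

lemma exists_abs_le_mul_add_one_rpow {c : ℕ → ℝ} {A θ : ℝ} (hθ : 0 ≤ θ) (hA : 0 ≤ A)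
    (hc : ∀ k : ℕ, 1 ≤ k → |c k| ≤ A * (k : ℝ) ^ (-θ)) :
    ∃ B : ℝ, ∀ k : ℕ, |c k| ≤ B * ((k : ℝ) + 1) ^ (-θ) := by
  refine ⟨|c 0| + A * 2 ^ θ, fun k ↦ ?_⟩
  rcases k.eq_zero_or_pos with rfl | hk
  · have : 0 ≤ A * (2 : ℝ) ^ θ := by positivity
    simpa using this
  · have hk' : (1 : ℝ) ≤ k := by exact_mod_cast hk
    have h1 : (k : ℝ) ^ (-θ) ≤ 2 ^ θ * ((k : ℝ) + 1) ^ (-θ) := by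
      have : (k : ℝ) ^ (-θ) = 2 ^ θ * (2 * k : ℝ) ^ (-θ) := by
        rw [Real.mul_rpow (by norm_num) (by positivity), ← mul_assoc, ← Real.rpow_add (by norm_num)]
        simp
      rw [this]
      exact mul_le_mul_of_nonneg_left
        (Real.rpow_le_rpow_of_nonpos (by positivity) (by linarith) (by linarith)) (by positivity)
    calc |c k| ≤ A * (k : ℝ) ^ (-θ) := hc k hk
      _ ≤ A * (2 ^ θ * ((k : ℝ) + 1) ^ (-θ)) := by gcongr
      _ ≤ |c 0| * ((k : ℝ) + 1) ^ (-θ) + A * (2 ^ θ * ((k : ℝ) + 1) ^ (-θ)) :=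
        le_add_of_nonneg_left (by positivity)
      _ = _ := by ring

lemma moebiusExpSum_isBigO_atTop {α β A θ : ℝ} (hα : 1 < α) (hβ : 0 < β) (hθ : 0 ≤ θ)
    (hA : 0 ≤ A) (hc : ∀ k : ℕ, 1 ≤ k → |cCoeff α β k| ≤ A * (k : ℝ) ^ (-θ)) :
    moebiusExpSum α β =O[atTop] fun t ↦ t ^ (-θ) := by
  obtain ⟨B, hB⟩ := exists_abs_le_mul_add_one_rpow hθ hA hc
  obtain ⟨m, hm⟩ := exists_nat_ge θ
  refine IsBigO.of_bound (B * (1 + ((m : ℝ) + 1) ^ m)) ?_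
  filter_upwards [eventually_gt_atTop 0] with t ht
  rw [moebiusExpSum_eq_exp_mul_tsum hα hβ ht.le, Real.norm_eq_abs, Real.norm_eq_abs,
    abs_of_nonneg (Real.rpow_nonneg ht.le _)]
  exact abs_exp_mul_tsum_le hθ hm hB ht

lemma moebiusExpSum_isBigO_nhdsGT_zero {α : ℝ} (β : ℝ) (hα : 1 < α) :
    moebiusExpSum α β =O[𝓝[>] 0] fun t ↦ t ^ (-0 : ℝ) := by
  have h := (continuousOn_moebiusExpSum β hα) 0 Set.self_mem_Ici
  simpa using (h.mono Set.Ioi_subset_Ici_self).tendsto.isBigO_one ℝ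

lemma differentiableAt_mellin_moebiusExpSum {α β A θ : ℝ} {z : ℂ} (hα : 1 < α) (hβ : 0 < β)
    (hA : 0 ≤ A) (hc : ∀ k : ℕ, 1 ≤ k → |cCoeff α β k| ≤ A * (k : ℝ) ^ (-θ))
    (hz : 0 < z.re) (hzθ : z.re < θ) :
    DifferentiableAt ℂ (mellin fun t ↦ (moebiusExpSum α β t : ℂ)) z := by
  refine mellin_differentiableAt_of_isBigO_rpow (a := θ) (b := 0) ?_ ?_ hzθ ?_ hz
  · refine ContinuousOn.locallyIntegrableOn ?_ measurableSet_Ioi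
    exact Complex.continuous_ofReal.comp_continuousOn
      ((continuousOn_moebiusExpSum β hα).mono Set.Ioi_subset_Ici_self)
  · exact Complex.isBigO_ofReal_left.2
      (moebiusExpSum_isBigO_atTop hα hβ (hz.trans hzθ).le hA hc)
  · exact Complex.isBigO_ofReal_left.2 (moebiusExpSum_isBigO_nhdsGT_zero β hα)

/-- For `1 < Re s < α` the Mellin transform of `moebiusExpSum` at `(α - s) / β` is
`Γ((α - s) / β) / ζ(s)`. -/
lemma mellin_moebiusExpSum_mul_riemannZeta {α β : ℝ} {s : ℂ} (hβ : 0 < β) (hs : 1 < s.re)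
    (hsα : s.re < α) :
    mellin (fun t ↦ (moebiusExpSum α β t : ℂ)) ((α - s) / β) * riemannZeta s =
      Complex.Gamma ((α - s) / β) := by
  have hre : ((α - s) / β : ℂ).re = (α - s.re) / β := by simp
  have hcoeff (n : ℕ) : (((moebius n : ℝ) * (n : ℝ) ^ (-α) : ℝ) : ℂ) /
      (((n : ℝ) ^ (-β) : ℝ) : ℂ) ^ ((α - s) / β : ℂ) =
      LSeries.term (fun n ↦ (moebius n : ℂ)) s n := by
    rcases n.eq_zero_or_pos with rfl | hn
    · simp
    · have hn' : (n : ℂ) ≠ 0 := by exact_mod_cast hn.ne'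
      have hβ' : (β : ℂ) ≠ 0 := by exact_mod_cast hβ.ne'
      have hlog : (Complex.log (n : ℂ)).im = 0 := by
        rw [← Complex.natCast_log, Complex.ofReal_im]
      rw [LSeries.term_of_ne_zero hn.ne']
      push_cast
      rw [Complex.ofReal_cpow n.cast_nonneg, Complex.ofReal_cpow n.cast_nonneg, mul_div_assoc,
        div_eq_mul_inv (moebius n : ℂ)]
      push_cast
      congr 1
      rw [← Complex.cpow_mul, ← Complex.cpow_sub _ _ hn', ← Complex.cpow_neg]
      · congr 1
        field_simp
        ring
      all_goals
        have : (Complex.log (n : ℂ) * -(β : ℂ)).im = 0 := by simp [hlog]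
        rw [this]
        linarith [Real.pi_pos]
  have hmoebius := LSeriesSummable_moebius_iff.2 hs
  have h := hasSum_mellin
    (a := fun n : ℕ ↦ (((moebius n : ℝ) * (n : ℝ) ^ (-α) : ℝ) : ℂ))
    (p := fun n : ℕ ↦ (n : ℝ) ^ (-β)) (F := fun t ↦ (moebiusExpSum α β t : ℂ))
    (s := (α - s) / β) (fun n ↦ ?_) (by rw [hre]; exact div_pos (by linarith) hβ)
    (fun t ht ↦ ?_) ?_
  · simp_rw [mul_div_assoc, hcoeff] at h
    rw [← h.tsum_eq, tsum_mul_left, mul_assoc, mul_comm (∑' _, _)]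
    have hL := LSeries_zeta_mul_Lseries_moebius hs
    rw [LSeries_zeta_eq_riemannZeta hs, LSeries] at hL
    rw [hL, mul_one]
  · rcases n.eq_zero_or_pos with rfl | hn
    · simp
    · exact .inr (by positivity)
  · exact_mod_cast hasSum_moebiusExpSum β (hs.trans hsα) (le_of_lt ht)
  · refine hmoebius.norm.congr fun n ↦ ?_
    rw [← hcoeff, norm_div]
    rcases n.eq_zero_or_pos with rfl | hn
    · simp
    · rw [Complex.norm_cpow_eq_rpow_re_of_pos (by positivity)]

/-- The entire function `(s - 1) ζ(s)`. -/
lemma differentiable_update_sub_one_mul_riemannZeta :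
    Differentiable ℂ (Function.update (fun s ↦ (s - 1) * riemannZeta s) 1 1) := by
  intro s
  rcases eq_or_ne s 1 with rfl | hs
  · refine (Complex.analyticAt_of_differentiable_on_punctured_nhds_of_continuousAt ?_
      (continuousAt_update_same.2 riemannZeta_residue_one)).differentiableAt
    filter_upwards [self_mem_nhdsWithin] with z hz
    refine DifferentiableAt.congr_of_eventuallyEq (f := fun s ↦ (s - 1) * riemannZeta s) ?_
      (eventuallyEq_of_mem (isOpen_ne.mem_nhds hz) fun w hw ↦ Function.update_of_ne hw _ _)
    exact (by fun_prop : DifferentiableAt ℂ (fun s : ℂ ↦ s - 1) z).mul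
      (differentiableAt_riemannZeta hz)
  · refine DifferentiableAt.congr_of_eventuallyEq (f := fun s ↦ (s - 1) * riemannZeta s) ?_
      (eventuallyEq_of_mem (isOpen_ne.mem_nhds hs) fun w hw ↦ Function.update_of_ne hw _ _)
    exact (by fun_prop : DifferentiableAt ℂ (fun s : ℂ ↦ s - 1) s).mul
      (differentiableAt_riemannZeta hs)

/-- Zero-free region criterion: if `|c_k(α,β)| ≤ A k^{-(α-ρ)/β}` for all `k ≥ 1`
(for some `A > 0`), with `1 < α`, `0 < β`, `1/2 ≤ ρ < α`, then `ζ` has no zeros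
with real part `> ρ`. -/
theorem zero_free_region_of_coeff_decay (α β ρ : ℝ) (hα : 1 < α) (hβ : 0 < β)
    (hρ : 1 / 2 ≤ ρ) (hρα : ρ < α)
    (h : ∃ A : ℝ, 0 < A ∧ ∀ k : ℕ, 1 ≤ k →
      |cCoeff α β k| ≤ A * (k : ℝ) ^ (-((α - ρ) / β))) :
    ∀ s : ℂ, ρ < s.re → riemannZeta s ≠ 0 := by
  obtain ⟨A, hA, hc⟩ := h
  intro s hs hzero
  have hs1 : s.re < 1 := by
    by_contra! h1
    exact riemannZeta_ne_zero_of_one_le_re h1 hzero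
  have hs_ne : s ≠ 1 := by
    rintro rfl
    simp at hs1
  set U : Set ℂ := Complex.re ⁻¹' Set.Ioo ρ α with hU
  have hUo : IsOpen U := isOpen_Ioo.preimage Complex.continuous_re
  have hUc : IsPreconnected U :=
    ((convex_Ioo ρ α).linear_preimage Complex.reLm).isPreconnected
  have hre (w : ℂ) : ((α - w) / β : ℂ).re = (α - w.re) / β := by simp
  have hpos {w : ℂ} (hw : w ∈ U) : 0 < ((α - w) / β : ℂ).re := by
    rw [hre]
    exact div_pos (sub_pos.2 hw.2) hβ
  have hlin (w : ℂ) : DifferentiableAt ℂ (fun w : ℂ ↦ (α - w) / β) w := by fun_prop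
  set Z := Function.update (fun s ↦ (s - 1) * riemannZeta s) 1 1 with hZ
  set M : ℂ → ℂ := fun w ↦ mellin (fun t ↦ (moebiusExpSum α β t : ℂ)) ((α - w) / β) * Z w with hM
  set G : ℂ → ℂ := fun w ↦ (w - 1) * Complex.Gamma ((α - w) / β) with hG
  have hMd : DifferentiableOn ℂ M U := fun w hw ↦ by
    have hd := differentiableAt_mellin_moebiusExpSum hα hβ hA.le hc (hpos hw)
      (by rw [hre]; exact div_lt_div_of_pos_right (by linarith [hw.1]) hβ)
    exact ((hd.comp w (hlin w)).mul
      (differentiable_update_sub_one_mul_riemannZeta w)).differentiableWithinAt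
  have hGd : DifferentiableOn ℂ G U := fun w hw ↦ by
    have hd := Complex.differentiableAt_Gamma ((α - w) / β) fun m hm ↦ by
      have h0 := hpos hw
      rw [hm, Complex.neg_re, Complex.natCast_re] at h0
      linarith [m.cast_nonneg (α := ℝ)]
    exact ((by fun_prop : DifferentiableAt ℂ (fun w : ℂ ↦ w - 1) w).mul
      (hd.comp w (hlin w))).differentiableWithinAt
  obtain ⟨x, hx1, hxα⟩ := exists_between hα
  have hMG : M =ᶠ[𝓝 (x : ℂ)] G := by
    have hV : Complex.re ⁻¹' Set.Ioo 1 α ∈ 𝓝 (x : ℂ) :=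
      (isOpen_Ioo.preimage Complex.continuous_re).mem_nhds (by simp [hx1, hxα])
    filter_upwards [hV] with w hw
    have hw1 : w ≠ 1 := by
      rintro rfl
      simp at hw
    simp only [hM, hG, hZ, Function.update_of_ne hw1]
    rw [mul_left_comm, mellin_moebiusExpSum_mul_riemannZeta hβ hw.1 hw.2]
  have hxU : (x : ℂ) ∈ U := by
    simp only [hU, Set.mem_preimage, Complex.ofReal_re, Set.mem_Ioo]
    exact ⟨by linarith, hxα⟩
  have hsU : s ∈ U := ⟨hs, by linarith⟩
  have heq := (hMd.analyticOnNhd hUo).eqOn_of_preconnected_of_eventuallyEq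
    (hGd.analyticOnNhd hUo) hUc hxU hMG hsU
  simp only [hM, hG, hZ, Function.update_of_ne hs_ne, hzero, mul_zero] at heq
  exact mul_ne_zero (sub_ne_zero.2 hs_ne) (Complex.Gamma_ne_zero_of_re_pos (hpos hsU)) heq.symm
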